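/- Let X be a Tychonoff space with dim X = 0 and let Ψ′ ⊆ C(X) be countable. Then there exist a countable admissible set Ψ ⊆ C(X) containing Ψ′, and a metrizable compactification X̄_Ψ of X_Ψ = (△Ψ)(X) with dim X̄_Ψ = 0 having a countable base ℬ, such that: (i) X̄_Ψ = (△Ψ̄)(βX), where Ψ̄ = { f̄ : f ∈ Ψ } ⊆ C(βX, [−∞, ∞]) consists of the extensions of members of Ψ over βX; (ii) each projection π_f, f ∈ Ψ, extends to a continuous map π̄_f: X̄_Ψ → [−∞, ∞]; (iii) E(X_Ψ) = { π_f : f ∈ Ψ } is a countable QS-algebra on X_Ψ, and E(X̄_Ψ) = { π̄_f : f ∈ Ψ } contains a countable QS-algebra on X̄_Ψ satisfying condition (2.3); (iv) for every finite open cover γ of X̄_Ψ with elements of ℬ, the family E(X̄_Ψ) contains a partition of unity subordinated to γ. -/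

import Mathlib

open Set Topology TopologicalSpace

universe u

def IsCozero {X : Type*} [TopologicalSpace X] (U : Set X) : Prop :=
  ∃ f : X → ℝ, Continuous f ∧ U = {x | f x ≠ 0}

/-- Covering dimension at most `0`, via finite functionally open (cozero) covers. -/
def CovDimLE0 (X : Type*) [TopologicalSpace X] : Prop :=
  ∀ (n : ℕ) (U : Fin n → Set X), (∀ i, IsCozero (U i)) → (⋃ i, U i) = Set.univ →
    ∃ (m : ℕ) (V : Fin m → Set X), (∀ j, IsCozero (V j)) ∧ (⋃ j, V j) = Set.univ ∧
      (∀ j, ∃ i, V j ⊆ U i) ∧ Pairwise (Function.onFun Disjoint V)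

/-- `dim X = 0`. -/
def CovDimEq0 (X : Type*) [TopologicalSpace X] : Prop :=
  Nonempty X ∧ CovDimLE0 X

/-- A QS-algebra on `X`. -/
def IsQSAlgebra {X : Type*} [TopologicalSpace X] (E : Set (X → ℝ)) : Prop :=
  (∀ f ∈ E, Continuous f) ∧
  (∀ f ∈ E, ∀ g ∈ E, f + g ∈ E ∧ f * g ∈ E) ∧
  (∀ f ∈ E, ∀ q : ℚ, (q : ℝ) • f ∈ E) ∧
  (∀ x : X, ∀ U ∈ nhds x, ∃ f ∈ E, f x = 1 ∧ ∀ y ∉ U, f y = 0)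

/-- Condition (2.3). -/
def SatisfiesCond23 {X : Type*} [TopologicalSpace X] (E : Set (X → ℝ)) : Prop :=
  ∀ K : Set X, IsCompact K → ∀ W : Set X, IsOpen W → K ⊆ W →
    ∃ f ∈ E, (∀ x ∈ K, f x = 1) ∧ (∀ x ∉ W, f x = 0) ∧ ∀ x, f x ∈ Set.Icc (0 : ℝ) 1

/-- The diagonal product `△Ψ : X → ℝ^Ψ` of a family `Ψ ⊆ C(X)`. -/
def diagR {X : Type u} (Ψ : Set (X → ℝ)) : X → (Ψ → ℝ) :=
  fun x f => (f : X → ℝ) x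

/-- `X_Ψ = (△Ψ)(X)`. -/
def XPsi {X : Type u} (Ψ : Set (X → ℝ)) : Set (Ψ → ℝ) := Set.range (diagR Ψ)

/-- `Ψ` is admissible: the family `π(Ψ)` of projections is a QS-algebra on `X_Ψ`. -/
def IsAdmissible {X : Type u} [TopologicalSpace X] (Ψ : Set (X → ℝ)) : Prop :=
  IsQSAlgebra {h : ↥(XPsi Ψ) → ℝ | ∃ f : Ψ, ∀ z : ↥(XPsi Ψ), h z = (z : Ψ → ℝ) f}

/-- The diagonal product `△Ψ̄ : βX → [-∞,∞]^Ψ` of the family of extensions `ext f` of the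
members `f` of `Ψ` over `βX`. -/
def diagExt {X : Type u} [TopologicalSpace X] (Ψ : Set (X → ℝ))
    (ext : Ψ → StoneCech X → EReal) : StoneCech X → (Ψ → EReal) :=
  fun z f => ext f z

/-- `X̄_Ψ = (△Ψ̄)(βX)`. -/
def XbarPsi {X : Type u} [TopologicalSpace X] (Ψ : Set (X → ℝ))
    (ext : Ψ → StoneCech X → EReal) : Set (Ψ → EReal) :=
  Set.range (diagExt Ψ ext)

theorem exists_countable_superset_closed {α ι : Type*} [Countable ι] (op : ι → α → α → α)
    {S : Set α} (hS : S.Countable) :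
    ∃ T : Set α, T.Countable ∧ S ⊆ T ∧ ∀ i, ∀ a ∈ T, ∀ b ∈ T, op i a b ∈ T := by
  let step : Set α → Set α := fun T => T ∪ ⋃ i, Set.image2 (op i) T T
  let seq : ℕ → Set α := fun n => step^[n] S
  have hsucc : ∀ n, seq (n + 1) = step (seq n) := fun n => Function.iterate_succ_apply' step n S
  have hmono : Monotone seq := monotone_nat_of_le_succ fun n => by
    rw [hsucc]
    exact subset_union_left
  refine ⟨⋃ n, seq n, countable_iUnion fun n => ?_, subset_iUnion seq 0, ?_⟩
  · induction n with
    | zero => exact hS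
    | succ n ih =>
      rw [hsucc]
      exact ih.union (countable_iUnion fun i => ih.image2 ih (op i))
  · intro i a ha b hb
    obtain ⟨m, hm⟩ := mem_iUnion.1 ha
    obtain ⟨n, hn⟩ := mem_iUnion.1 hb
    refine mem_iUnion.2 ⟨max m n + 1, ?_⟩
    rw [hsucc]
    exact Or.inr (mem_iUnion.2 ⟨i, Set.mem_image2_of_mem (hmono (le_max_left m n) hm)
      (hmono (le_max_right m n) hn)⟩)

theorem isCozero_lt {X : Type*} [TopologicalSpace X] {f g : X → ℝ} (hf : Continuous f)
    (hg : Continuous g) : IsCozero {x | f x < g x} := by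
  refine ⟨fun x => max (g x - f x) 0, by fun_prop, ?_⟩
  ext x
  simp

theorem IsCozero.isOpen {X : Type*} [TopologicalSpace X] {U : Set X} (hU : IsCozero U) :
    IsOpen U := by
  obtain ⟨f, hf, rfl⟩ := hU
  exact isOpen_ne_fun hf continuous_const

theorem IsClopen.isCozero {X : Type*} [TopologicalSpace X] {U : Set X} (hU : IsClopen U) :
    IsCozero U := by
  refine ⟨U.indicator 1, hU.continuous_indicator continuous_const, ?_⟩
  ext x
  simp

/-- In a space of covering dimension zero, a cozero set and a zero set inside it are separated
by a clopen set. -/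
theorem CovDimLE0.exists_isClopen_between {X : Type*} [TopologicalSpace X] (hX : CovDimLE0 X)
    {f : X → ℝ} (hf : Continuous f) {p q : ℝ} (hpq : p < q) :
    ∃ A : Set X, IsClopen A ∧ (∀ x, f x ≤ p → x ∈ A) ∧ ∀ x ∈ A, f x < q := by
  obtain ⟨m, V, hV, hcov, href, hdisj⟩ := hX 2 ![{x | f x < q}, {x | p < f x}]
    (by
      intro i
      fin_cases i
      · exact isCozero_lt hf continuous_const
      · exact isCozero_lt continuous_const hf)
    (by
      refine eq_univ_of_forall fun x => mem_iUnion.2 ?_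
      rcases lt_or_ge (f x) q with h | h
      · exact ⟨0, h⟩
      · exact ⟨1, hpq.trans_le h⟩)
  let I : Set (Fin m) := {j | V j ⊆ {x | f x < q}}
  have hcompl : (⋃ j ∈ I, V j)ᶜ = ⋃ j ∈ Iᶜ, V j := by
    ext x
    obtain ⟨k, hk⟩ := mem_iUnion.1 (hcov.symm ▸ mem_univ x : x ∈ ⋃ j, V j)
    have huniq : ∀ j, x ∈ V j → j = k := fun j hj => by
      by_contra hne
      exact Set.disjoint_left.1 (hdisj hne) hj hk
    simp only [mem_compl_iff, mem_iUnion, not_exists]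
    constructor
    · intro h
      exact ⟨k, fun hkI => h k hkI hk, hk⟩
    · rintro ⟨j, hjI, hj⟩ i hiI hi
      rw [huniq j hj, ← huniq i hi] at hjI
      exact hjI hiI
  refine ⟨⋃ j ∈ I, V j, ⟨⟨?_⟩, isOpen_biUnion fun j _ => (hV j).isOpen⟩, ?_, ?_⟩
  · rw [hcompl]
    exact isOpen_biUnion fun j _ => (hV j).isOpen
  · intro x hx
    obtain ⟨k, hk⟩ := mem_iUnion.1 (hcov.symm ▸ mem_univ x : x ∈ ⋃ j, V j)
    refine mem_biUnion (?_ : k ∈ I) hk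
    obtain ⟨i, hi⟩ := href k
    fin_cases i
    · exact hi
    · exact absurd (hi hk : p < f x) hx.not_gt
  · intro x hx
    obtain ⟨j, hj, hxj⟩ := mem_iUnion₂.1 hx
    exact hj hxj

theorem CovDimLE0.exists_countable_superset_closed {X : Type*} [TopologicalSpace X]
    (hX : CovDimLE0 X) {S : Set (X → ℝ)} (hS : S.Countable) (hSc : ∀ f ∈ S, Continuous f) :
    ∃ T : Set (X → ℝ), T.Countable ∧ (∀ f ∈ T, Continuous f) ∧ S ⊆ T ∧ 1 ∈ T ∧
      (∀ f ∈ T, ∀ g ∈ T, f + g ∈ T) ∧ (∀ f ∈ T, ∀ g ∈ T, f * g ∈ T) ∧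
      (∀ f ∈ T, ∀ q : ℚ, (q : ℝ) • f ∈ T) ∧
      ∀ f ∈ T, ∀ p q : ℚ, p < q → ∃ A : Set X, A.indicator 1 ∈ T ∧
        (∀ x, f x ≤ p → x ∈ A) ∧ ∀ x ∈ A, f x < q := by
  have hsep : ∀ (f : C(X, ℝ)) (r : ℚ × ℚ), ∃ A : Set X, IsClopen A ∧
      (r.1 < r.2 → (∀ x, f x ≤ r.1 → x ∈ A) ∧ ∀ x ∈ A, f x < r.2) := by
    intro f r
    by_cases h : r.1 < r.2
    · obtain ⟨A, hA, h₁⟩ := hX.exists_isClopen_between f.continuous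
        (Rat.cast_lt.2 h : (r.1 : ℝ) < r.2)
      exact ⟨A, hA, fun _ => h₁⟩
    · exact ⟨∅, isClopen_empty, fun h' => absurd h' h⟩
  choose A hA hAsep using hsep
  let ind : C(X, ℝ) → ℚ × ℚ → C(X, ℝ) := fun f r =>
    ⟨(A f r).indicator 1, (hA f r).continuous_indicator continuous_const⟩
  let op : Bool ⊕ ℚ ⊕ ℚ × ℚ → C(X, ℝ) → C(X, ℝ) → C(X, ℝ) :=
    Sum.elim (fun b f g => if b then f + g else f * g)
      (Sum.elim (fun q f _ => (q : ℝ) • f) (fun r f _ => ind f r))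
  have hS' : (insert 1 ((⇑) ⁻¹' S) : Set C(X, ℝ)).Countable :=
    (hS.preimage_of_injOn DFunLike.coe_injective.injOn).insert 1
  obtain ⟨T, hT, hST, hop⟩ := _root_.exists_countable_superset_closed op hS'
  refine ⟨(⇑) '' T, hT.image _, ?_, ?_, ?_, ?_, ?_, ?_, ?_⟩
  · rintro _ ⟨f, -, rfl⟩
    exact f.continuous
  · intro f hf
    exact ⟨⟨f, hSc f hf⟩, hST (Or.inr hf), rfl⟩
  · exact ⟨1, hST (Or.inl rfl), rfl⟩
  · rintro _ ⟨f, hf, rfl⟩ _ ⟨g, hg, rfl⟩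
    exact ⟨_, hop (Sum.inl true) f hf g hg, rfl⟩
  · rintro _ ⟨f, hf, rfl⟩ _ ⟨g, hg, rfl⟩
    exact ⟨_, hop (Sum.inl false) f hf g hg, rfl⟩
  · rintro _ ⟨f, hf, rfl⟩ q
    exact ⟨_, hop (Sum.inr (Sum.inl q)) f hf f hf, rfl⟩
  · rintro _ ⟨f, hf, rfl⟩ p q hpq
    exact ⟨A f (p, q), ⟨_, hop (Sum.inr (Sum.inr (p, q))) f hf f hf, rfl⟩,
      hAsep f (p, q) hpq⟩

/-- A Boolean algebra of clopen sets that separates the points of a compact space interpolates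
between compact sets and their open neighbourhoods. -/
theorem exists_mem_between_of_separates {Y : Type*} [TopologicalSpace Y] [CompactSpace Y]
    {P : Set Y → Prop} (hclopen : ∀ D, P D → IsClopen D) (hcompl : ∀ D, P D → P Dᶜ)
    (hinter : ∀ D E, P D → P E → P (D ∩ E)) (huniv : P univ)
    (hsep : ∀ x y, x ≠ y → ∃ D, P D ∧ x ∈ D ∧ y ∉ D)
    {K W : Set Y} (hK : IsCompact K) (hW : IsOpen W) (hKW : K ⊆ W) :
    ∃ D, P D ∧ K ⊆ D ∧ D ⊆ W := by
  have hunion : ∀ D E, P D → P E → P (D ∪ E) := fun D E hD hE => by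
    have := hcompl _ (hinter _ _ (hcompl _ hD) (hcompl _ hE))
    rwa [compl_inter, compl_compl, compl_compl] at this
  have hempty : P ∅ := compl_univ (α := Y) ▸ hcompl _ huniv
  have hpoint : ∀ x ∈ W, ∃ D, P D ∧ x ∈ D ∧ D ⊆ W := by
    intro x hx
    obtain ⟨D, hD, hxD, hDW⟩ : ∃ D, P D ∧ x ∈ D ∧ Disjoint D Wᶜ := by
      refine hW.isClosed_compl.isCompact.induction_on
        (p := fun s => ∃ D, P D ∧ x ∈ D ∧ Disjoint D s) ⟨univ, huniv, trivial, disjoint_bot_right⟩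
        ?_ ?_ ?_
      · rintro s t hst ⟨D, hD, hxD, hd⟩
        exact ⟨D, hD, hxD, hd.mono_right hst⟩
      · rintro s t ⟨D, hD, hxD, hd⟩ ⟨E, hE, hxE, he⟩
        exact ⟨D ∩ E, hinter D E hD hE, ⟨hxD, hxE⟩,
          (hd.mono_left inter_subset_left).union_right (he.mono_left inter_subset_right)⟩
      · intro y hy
        obtain ⟨D, hD, hxD, hyD⟩ := hsep x y (fun h => hy (h ▸ hx))
        exact ⟨Dᶜ, mem_nhdsWithin_of_mem_nhds ((hclopen D hD).compl.isOpen.mem_nhds hyD),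
          D, hD, hxD, disjoint_compl_right⟩
    exact ⟨D, hD, hxD, disjoint_compl_right_iff_subset.1 hDW⟩
  refine hK.induction_on (p := fun s => ∃ D, P D ∧ s ⊆ D ∧ D ⊆ W)
    ⟨∅, hempty, subset_rfl, empty_subset _⟩ ?_ ?_ ?_
  · rintro s t hst ⟨D, hD, hs, hDW⟩
    exact ⟨D, hD, hst.trans hs, hDW⟩
  · rintro s t ⟨D, hD, hs, hDW⟩ ⟨E, hE, ht, hEW⟩
    exact ⟨D ∪ E, hunion D E hD hE, union_subset_union hs ht, union_subset hDW hEW⟩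
  · intro y hy
    obtain ⟨D, hD, hyD, hDW⟩ := hpoint y (hKW hy)
    exact ⟨D, mem_nhdsWithin_of_mem_nhds ((hclopen D hD).isOpen.mem_nhds hyD), D, hD,
      subset_rfl, hDW⟩

theorem exists_disjoint_isClopen_refinement {Y : Type*} [TopologicalSpace Y] [CompactSpace Y]
    [T2Space Y]
    (hY : ∀ K W : Set Y, IsCompact K → IsOpen W → K ⊆ W → ∃ D, IsClopen D ∧ K ⊆ D ∧ D ⊆ W)
    {n : ℕ} {U : Fin n → Set Y} (hU : ∀ i, IsOpen (U i)) (hcov : ⋃ i, U i = univ) :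
    ∃ V : Fin n → Set Y, (∀ i, IsClopen (V i)) ∧ ⋃ i, V i = univ ∧ (∀ i, V i ⊆ U i) ∧
      Pairwise (Function.onFun Disjoint V) := by
  obtain ⟨K, hKcov, hK, hKU⟩ := exists_subset_iUnion_closed_subset isClosed_univ hU
    (fun _ _ => Set.toFinite _) hcov.ge
  choose D hD hKD hDU using fun i => hY (K i) (U i) (hK i).isCompact (hU i) (hKU i)
  refine ⟨disjointed D, fun i => ?_, ?_, fun i => (disjointed_subset D i).trans (hDU i),
    disjoint_disjointed D⟩
  · exact disjointedRec (fun _ j ht => ht.diff (hD j)) (hD i)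
  · rw [iUnion_disjointed]
    exact univ_subset_iff.1 (hKcov.trans (iUnion_mono hKD))

theorem covDimLE0_of_isClopen_between {Y : Type*} [TopologicalSpace Y] [CompactSpace Y]
    [T2Space Y]
    (hY : ∀ K W : Set Y, IsCompact K → IsOpen W → K ⊆ W → ∃ D, IsClopen D ∧ K ⊆ D ∧ D ⊆ W) :
    CovDimLE0 Y := by
  intro n U hU hcov
  obtain ⟨V, hV, hVcov, hVU, hdisj⟩ :=
    exists_disjoint_isClopen_refinement hY (fun i => (hU i).isOpen) hcov
  exact ⟨n, V, fun i => (hV i).isCozero, hVcov, fun i => ⟨i, hVU i⟩, hdisj⟩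

theorem statement10 {X : Type u} [TopologicalSpace X] [T35Space X]
    (hX : CovDimEq0 X)
    (Ψ' : Set (X → ℝ)) (hΨ'count : Ψ'.Countable) (hΨ'cont : ∀ f ∈ Ψ', Continuous f) :
    ∃ Ψ : Set (X → ℝ), Ψ.Countable ∧ (∀ f ∈ Ψ, Continuous f) ∧ Ψ' ⊆ Ψ ∧
      IsAdmissible Ψ ∧
      -- (i) `X̄_Ψ = (△Ψ̄)(βX)` where `Ψ̄` consists of the extensions of members of `Ψ`
      ∃ ext : Ψ → StoneCech X → EReal,
        (∀ f : Ψ, Continuous (ext f)) ∧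
        (∀ (f : Ψ) (x : X), ext f (stoneCechUnit x) = ((f : X → ℝ) x : EReal)) ∧
        -- `X̄_Ψ` is a compact metrizable space with `dim X̄_Ψ = 0`
        CompactSpace ↥(XbarPsi Ψ ext) ∧
        MetrizableSpace ↥(XbarPsi Ψ ext) ∧
        CovDimEq0 ↥(XbarPsi Ψ ext) ∧
        -- `X̄_Ψ` is a compactification of `X_Ψ`: the canonical map `X_Ψ → X̄_Ψ`
        -- is a dense topological embedding
        (∃ ι : ↥(XPsi Ψ) → ↥(XbarPsi Ψ ext),
          (∀ (p : ↥(XPsi Ψ)) (f : Ψ), (ι p : Ψ → EReal) f = ((p : Ψ → ℝ) f : EReal)) ∧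
          Topology.IsEmbedding ι ∧ DenseRange ι) ∧
        -- (ii) each projection `π_f` extends to a continuous map `π̄_f : X̄_Ψ → [-∞,∞]`
        (∀ f : Ψ, Continuous fun z : ↥(XbarPsi Ψ ext) => (z : Ψ → EReal) f) ∧
        -- (iii) `E(X̄_Ψ) = {π̄_f : f ∈ Ψ}` contains a countable QS-algebra on `X̄_Ψ`
        -- satisfying condition (2.3)
        (∃ C : Set (↥(XbarPsi Ψ ext) → ℝ), C.Countable ∧ IsQSAlgebra C ∧
          SatisfiesCond23 C ∧
          ∀ h ∈ C, ∃ f : Ψ, ∀ z : ↥(XbarPsi Ψ ext), (h z : EReal) = (z : Ψ → EReal) f) ∧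
        -- (iv) a countable base `ℬ` of `X̄_Ψ` such that every finite open cover of `X̄_Ψ`
        -- by members of `ℬ` admits a partition of unity from `E(X̄_Ψ)` subordinated to it
        (∃ B : Set (Set ↥(XbarPsi Ψ ext)), B.Countable ∧ IsTopologicalBasis B ∧
          ∀ (k : ℕ) (U : Fin k → Set ↥(XbarPsi Ψ ext)),
            (∀ i, U i ∈ B) → (⋃ i, U i) = Set.univ →
            ∃ F : Fin k → ↥(XbarPsi Ψ ext) → ℝ,
              (∀ i, ∃ f : Ψ, ∀ z, ((F i z : EReal)) = (z : Ψ → EReal) f) ∧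
              (∀ i, Continuous (F i)) ∧
              (∀ i z, F i z ∈ Set.Icc (0 : ℝ) 1) ∧
              (∀ z, (∑ i, F i z) = 1) ∧
              (∀ i, ∀ z ∉ U i, F i z = 0)) := by
  classical
  obtain ⟨⟨x₀⟩, hX0⟩ := hX
  obtain ⟨Ψ, hΨ, hΨc, hΨ'Ψ, hone, hadd, hmul, hsmul, hind⟩ :=
    hX0.exists_countable_superset_closed hΨ'count hΨ'cont
  have hcoe : ∀ f : Ψ, Continuous fun x => ((f : X → ℝ) x : EReal) := fun f =>
    continuous_coe_real_ereal.comp (hΨc f f.2)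
  let ext : Ψ → StoneCech X → EReal := fun f => stoneCechExtend (hcoe f)
  have hextc : ∀ f : Ψ, Continuous (ext f) := fun f => continuous_stoneCechExtend (hcoe f)
  have hext : ∀ (f : Ψ) (x : X), ext f (stoneCechUnit x) = ((f : X → ℝ) x : EReal) :=
    fun f x => congrFun (stoneCechExtend_extends (hcoe f)) x
  have : Countable Ψ := hΨ.to_subtype
  have hdiagc : Continuous (diagExt Ψ ext) := continuous_pi hextc
  have hcompact : CompactSpace ↥(XbarPsi Ψ ext) :=
    isCompact_iff_compactSpace.1 (isCompact_range hdiagc)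
  have hmetr : MetrizableSpace ↥(XbarPsi Ψ ext) := by
    have : MetrizableSpace (Ψ → EReal) := inferInstance
    infer_instance
  let j : X → ↥(XbarPsi Ψ ext) := fun x => ⟨diagExt Ψ ext (stoneCechUnit x), mem_range_self _⟩
  have hj : ∀ (x : X) (f : Ψ), (j x : Ψ → EReal) f = ((f : X → ℝ) x : EReal) :=
    fun x f => hext f x
  have hjd : DenseRange j :=
    (rangeFactorization_surjective (f := diagExt Ψ ext)).denseRange.comp denseRange_stoneCechUnit
      (hdiagc.subtype_mk _)
  have hproj : ∀ f : Ψ, Continuous fun z : ↥(XbarPsi Ψ ext) => (z : Ψ → EReal) f :=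
    fun f => (continuous_apply f).comp continuous_subtype_val
  -- The continuous real functions on the compactification that are coordinate functions.
  let C : Set (↥(XbarPsi Ψ ext) → ℝ) := {h | Continuous h ∧
    ∃ f : Ψ, ∀ z : ↥(XbarPsi Ψ ext), (h z : EReal) = (z : Ψ → EReal) f}
  have hCof : ∀ (h : ↥(XbarPsi Ψ ext) → ℝ) (f : Ψ), Continuous h →
      (∀ x, h (j x) = (f : X → ℝ) x) → h ∈ C := by
    intro h f hh hhf
    refine ⟨hh, f, fun z => ?_⟩
    exact congrFun (hjd.equalizer (continuous_coe_real_ereal.comp hh) (hproj f)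
      (funext fun x => by simp [hj, hhf])) z
  have hCj : ∀ (h : ↥(XbarPsi Ψ ext) → ℝ) (f : Ψ),
      (∀ z : ↥(XbarPsi Ψ ext), (h z : EReal) = (z : Ψ → EReal) f) →
      ∀ x, h (j x) = (f : X → ℝ) x := by
    intro h f hh x
    have := hh (j x)
    rw [hj] at this
    exact_mod_cast this
  have hCadd : ∀ f ∈ C, ∀ g ∈ C, f + g ∈ C := by
    rintro f ⟨hf, f', hf'⟩ g ⟨hg, g', hg'⟩
    exact hCof _ ⟨_, hadd _ f'.2 _ g'.2⟩ (hf.add hg) fun x => by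
      simp [hCj f f' hf', hCj g g' hg']
  have hCmul : ∀ f ∈ C, ∀ g ∈ C, f * g ∈ C := by
    rintro f ⟨hf, f', hf'⟩ g ⟨hg, g', hg'⟩
    exact hCof _ ⟨_, hmul _ f'.2 _ g'.2⟩ (hf.mul hg) fun x => by
      simp [hCj f f' hf', hCj g g' hg']
  have hCsmul : ∀ f ∈ C, ∀ q : ℚ, (q : ℝ) • f ∈ C := by
    rintro f ⟨hf, f', hf'⟩ q
    exact hCof _ ⟨_, hsmul _ f'.2 q⟩ (hf.const_smul (q : ℝ)) fun x => by
      simp [hCj f f' hf']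
  have hCone : (1 : ↥(XbarPsi Ψ ext) → ℝ) ∈ C :=
    hCof _ ⟨1, hone⟩ continuous_const fun x => rfl
  have hCcount : C.Countable := by
    have : Nonempty Ψ := ⟨⟨1, hone⟩⟩
    choose! φ hφ using fun h (hh : h ∈ C) => hh.2
    refine MapsTo.countable_of_injOn (f := φ) (mapsTo_univ _ _) ?_ countable_univ
    intro h hh k hk hhk
    funext z
    have h₁ := hφ h hh z
    rw [hhk, ← hφ k hk z] at h₁
    exact_mod_cast h₁
  -- The clopen sets whose indicator is a coordinate function separate points.
  let P : Set ↥(XbarPsi Ψ ext) → Prop := fun D => IsClopen D ∧ D.indicator 1 ∈ C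
  have hPcompl : ∀ D, P D → P Dᶜ := by
    rintro D ⟨hD, hDC⟩
    refine ⟨hD.compl, ?_⟩
    convert hCadd _ hCone _ (hCsmul _ hDC (-1)) using 1
    rw [Set.indicator_compl]
    funext z
    simp [sub_eq_add_neg]
  have hPinter : ∀ D E, P D → P E → P (D ∩ E) := by
    rintro D E ⟨hD, hDC⟩ ⟨hE, hEC⟩
    refine ⟨hD.inter hE, ?_⟩
    rw [Set.inter_indicator_one]
    exact hCmul _ hDC _ hEC
  have hPuniv : P univ := ⟨isClopen_univ, by rwa [Set.indicator_univ]⟩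
  have hlt : ∀ (x y : ↥(XbarPsi Ψ ext)) (f : Ψ), (x : Ψ → EReal) f < (y : Ψ → EReal) f →
      ∃ D, P D ∧ x ∈ D ∧ y ∉ D := by
    intro x y f hxy
    obtain ⟨p, hxp, hpy⟩ := EReal.lt_iff_exists_rat_btwn.1 hxy
    obtain ⟨q, hpq, hqy⟩ := EReal.lt_iff_exists_rat_btwn.1 hpy
    have hpq' : p < q := by exact_mod_cast hpq
    obtain ⟨A, hA, hpA, hAq⟩ := hind f f.2 p q hpq'
    let g : Ψ := ⟨A.indicator 1, hA⟩
    have hjg : ∀ a, (j a : Ψ → EReal) g = ((A.indicator 1 a : ℝ) : EReal) := fun a => hj a g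
    have hg01 : ∀ z : ↥(XbarPsi Ψ ext), (z : Ψ → EReal) g = 1 ∨ (z : Ψ → EReal) g = 0 := by
      intro z
      refine hjd.induction_on z ((isClosed_eq (hproj g) continuous_const).union
        (isClosed_eq (hproj g) continuous_const)) fun a => ?_
      by_cases ha : a ∈ A <;> simp [hjg, ha]
    have hglow : ∀ z : ↥(XbarPsi Ψ ext),
        ((p : ℝ) : EReal) ≤ (z : Ψ → EReal) f ∨ (z : Ψ → EReal) g = 1 := by
      intro z
      refine hjd.induction_on z ((isClosed_le continuous_const (hproj f)).union
        (isClosed_eq (hproj g) continuous_const)) fun a => ?_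
      rw [hj, hjg]
      rcases le_total (p : ℝ) ((f : X → ℝ) a) with h | h
      · exact Or.inl (by exact_mod_cast h)
      · exact Or.inr (by simp [hpA a h])
    have hghigh : ∀ z : ↥(XbarPsi Ψ ext),
        (z : Ψ → EReal) f ≤ ((q : ℝ) : EReal) ∨ (z : Ψ → EReal) g = 0 := by
      intro z
      refine hjd.induction_on z ((isClosed_le (hproj f) continuous_const).union
        (isClosed_eq (hproj g) continuous_const)) fun a => ?_
      rw [hj, hjg]
      by_cases ha : a ∈ A
      · exact Or.inl (by exact_mod_cast (hAq a ha).le)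
      · exact Or.inr (by simp [ha])
    let D : Set ↥(XbarPsi Ψ ext) := {z | (z : Ψ → EReal) g = 1}
    have hDcompl : Dᶜ = {z : ↥(XbarPsi Ψ ext) | (z : Ψ → EReal) g = 0} := by
      ext z
      rcases hg01 z with h | h <;> simp [D, h]
    have hDclopen : IsClopen D := by
      refine ⟨isClosed_eq (hproj g) continuous_const, isClosed_compl_iff.1 ?_⟩
      rw [hDcompl]
      exact isClosed_eq (hproj g) continuous_const
    refine ⟨D, ⟨hDclopen, hDclopen.continuous_indicator continuous_const, g, fun z => ?_⟩, ?_, ?_⟩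
    · rcases hg01 z with h | h
      · rw [h, Set.indicator_of_mem (show z ∈ D from h)]
        simp
      · rw [h, Set.indicator_of_notMem (show z ∉ D by simp [D, h])]
        simp
    · exact (hglow x).resolve_left hxp.not_ge
    · have h : (y : Ψ → EReal) g = 0 := (hghigh y).resolve_left hqy.not_ge
      simp [D, h]
  have hPsep : ∀ x y : ↥(XbarPsi Ψ ext), x ≠ y → ∃ D, P D ∧ x ∈ D ∧ y ∉ D := by
    intro x y hxy
    obtain ⟨f, hf⟩ : ∃ f, (x : Ψ → EReal) f ≠ (y : Ψ → EReal) f :=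
      Function.ne_iff.1 (Subtype.coe_injective.ne hxy)
    rcases lt_or_gt_of_ne hf with h | h
    · exact hlt x y f h
    · obtain ⟨D, hD, hyD, hxD⟩ := hlt y x f h
      exact ⟨Dᶜ, hPcompl D hD, hxD, fun h => h hyD⟩
  have hbetween : ∀ K W : Set ↥(XbarPsi Ψ ext), IsCompact K → IsOpen W → K ⊆ W →
      ∃ D, P D ∧ K ⊆ D ∧ D ⊆ W := fun K W hK hW hKW =>
    exists_mem_between_of_separates (fun D hD => hD.1) hPcompl hPinter hPuniv hPsep hK hW hKW
  have hclopenP : ∀ D : Set ↥(XbarPsi Ψ ext), IsClopen D → P D := by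
    intro D hD
    obtain ⟨E, hE, hDE, hED⟩ := hbetween D D hD.isClosed.isCompact hD.isOpen subset_rfl
    rwa [hDE.antisymm hED]
  have hbetween' : ∀ K W : Set ↥(XbarPsi Ψ ext), IsCompact K → IsOpen W → K ⊆ W →
      ∃ D, IsClopen D ∧ K ⊆ D ∧ D ⊆ W := fun K W hK hW hKW =>
    (hbetween K W hK hW hKW).imp fun D hD => ⟨hD.1.1, hD.2⟩
  have hpoint : ∀ (x : ↥(XbarPsi Ψ ext)) (W : Set ↥(XbarPsi Ψ ext)), x ∈ W → IsOpen W →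
      ∃ D, IsClopen D ∧ x ∈ D ∧ D ⊆ W := fun x W hx hW => by
    obtain ⟨D, hD, hxD, hDW⟩ := hbetween' {x} W isCompact_singleton hW (by simpa using hx)
    exact ⟨D, hD, by simpa using hxD, hDW⟩
  have hmem : ∀ p : ↥(XPsi Ψ), (fun f => ((p : Ψ → ℝ) f : EReal)) ∈ XbarPsi Ψ ext := by
    rintro ⟨_, x, rfl⟩
    exact ⟨stoneCechUnit x, funext fun f => hext f x⟩
  let i : ↥(XPsi Ψ) → ↥(XbarPsi Ψ ext) := fun p => ⟨_, hmem p⟩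
  have hi : IsEmbedding i :=
    ((IsEmbedding.piMap fun _ : Ψ => EReal.isEmbedding_coe).comp
      IsEmbedding.subtypeVal).codRestrict _ hmem
  have hid : DenseRange i := hjd.mono <| by
    rintro _ ⟨x, rfl⟩
    exact ⟨⟨diagR Ψ x, x, rfl⟩, Subtype.ext (funext fun f => (hj x f).symm)⟩
  refine ⟨Ψ, hΨ, hΨc, hΨ'Ψ, ⟨?_, ?_, ?_, ?_⟩, ext, hextc, hext, hcompact, hmetr,
    ⟨⟨j x₀⟩, covDimLE0_of_isClopen_between hbetween'⟩, ⟨i, fun _ _ => rfl, hi, hid⟩, hproj,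
    ⟨C, hCcount, ⟨fun f hf => hf.1, fun f hf g hg => ⟨hCadd f hf g hg, hCmul f hf g hg⟩,
      hCsmul, ?_⟩, ?_, fun h hh => hh.2⟩, {D | IsClopen D}, ?_, ?_, ?_⟩
  · rintro h ⟨f, hf⟩
    rw [funext hf]
    exact (continuous_apply f).comp continuous_subtype_val
  · rintro h ⟨f, hf⟩ k ⟨g, hg⟩
    refine ⟨⟨⟨_, hadd _ f.2 _ g.2⟩, ?_⟩, ⟨⟨_, hmul _ f.2 _ g.2⟩, ?_⟩⟩
    · rintro ⟨_, x, rfl⟩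
      simp [hf, hg, diagR]
    · rintro ⟨_, x, rfl⟩
      simp [hf, hg, diagR]
  · rintro h ⟨f, hf⟩ q
    refine ⟨⟨_, hsmul _ f.2 q⟩, ?_⟩
    rintro ⟨_, x, rfl⟩
    simp [hf, diagR]
  · intro x U hU
    rw [hi.isInducing.nhds_eq_comap] at hU
    obtain ⟨W, hW, hWU⟩ := hU
    obtain ⟨D, hD, hxD, hDW⟩ := hpoint (i x) (interior W) (mem_interior_iff_mem_nhds.2 hW)
      isOpen_interior
    obtain ⟨-, f, hf⟩ := (hclopenP D hD).2
    refine ⟨fun z => D.indicator 1 (i z), ⟨f, fun z => ?_⟩, ?_, fun y hy => ?_⟩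
    · exact EReal.coe_injective (hf (i z))
    · simp [hxD]
    · exact Set.indicator_of_notMem (fun h => hy (hWU (show i y ∈ W from interior_subset (hDW h)))) _
  · intro x U hU
    obtain ⟨D, hD, hxD, hDU⟩ := hpoint x (interior U) (mem_interior_iff_mem_nhds.2 hU)
      isOpen_interior
    exact ⟨D.indicator 1, (hclopenP D hD).2, by simp [hxD], fun y hy =>
      Set.indicator_of_notMem (fun h => hy (interior_subset (hDU h))) _⟩
  · intro K hK W hW hKW
    obtain ⟨D, hD, hKD, hDW⟩ := hbetween K W hK hW hKW
    refine ⟨D.indicator 1, hD.2, fun x hx => by simp [hKD hx], fun x hx =>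
      Set.indicator_of_notMem (fun h => hx (hDW h)) _, fun x => ?_⟩
    by_cases hx : x ∈ D <;> simp [hx]
  · refine MapsTo.countable_of_injOn (f := fun D => D.indicator (1 : ↥(XbarPsi Ψ ext) → ℝ))
      (fun D hD => (hclopenP D hD).2) ?_ hCcount
    exact fun D _ E _ h => Set.indicator_one_inj ℝ h
  · refine isTopologicalBasis_of_isOpen_of_nhds (fun D hD => hD.isOpen) fun x W hx hW => ?_
    obtain ⟨D, hD, h⟩ := hpoint x W hx hW
    exact ⟨D, hD, h⟩
  · intro k U hU hcov
    obtain ⟨V, hV, hVcov, hVU, hdisj⟩ :=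
      exists_disjoint_isClopen_refinement hbetween' (fun i => (hU i).isOpen) hcov
    refine ⟨fun i => (V i).indicator 1, fun i => (hclopenP _ (hV i)).2.2,
      fun i => (hclopenP _ (hV i)).2.1, fun i z => ?_, fun z => ?_, fun i z hz =>
      Set.indicator_of_notMem (fun h => hz (hVU i h)) _⟩
    · by_cases hz : z ∈ V i <;> simp [hz]
    · obtain ⟨i, hi⟩ := mem_iUnion.1 (hVcov.symm ▸ mem_univ z : z ∈ ⋃ i, V i)
      rw [Finset.sum_eq_single i]
      · simp [hi]
      · intro l _ hl
        exact Set.indicator_of_notMem (fun h => Set.disjoint_left.1 (hdisj hl) h hi) _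
      · simp
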